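/- Let A be a positively graded commutative ring which is finitely generated as an A_0-algebra. Then the quasi-compact open subsets of Proj A form a basis of the topology of Proj A, and the intersection of any two quasi-compact open subsets of Proj A is quasi-compact. -/

import Mathlib

namespace ProjectiveSpectrum

variable {A σ : Type*} [CommRing A] [SetLike σ A] [AddSubmonoidClass σ A]
  (𝒜 : ℕ → σ) [GradedRing 𝒜]

/-- A homogeneous element of positive degree vanishing on the zero locus of a homogeneous ideal
lies in the radical of that ideal. -/
theorem mem_radical_of_zeroLocus_subset {I : HomogeneousIdeal 𝒜} {f : A} {d : ℕ} (hd : 0 < d)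
    (hf : f ∈ 𝒜 d) (h : zeroLocus 𝒜 (I : Set A) ⊆ zeroLocus 𝒜 {f}) : f ∈ I.toIdeal.radical := by
  rw [Ideal.radical_eq_sInf, Submodule.mem_sInf]
  rintro P ⟨hIP, hP⟩
  by_contra hfP
  let Q : HomogeneousIdeal 𝒜 := Ideal.homogeneousCore 𝒜 P
  have hQP : Q.toIdeal ≤ P := Ideal.toIdeal_homogeneousCore_le 𝒜 P
  have hfQ : f ∉ Q := fun hfQ ↦ hfP (hQP hfQ)
  let x : ProjectiveSpectrum 𝒜 :=
    ⟨Q, hP.homogeneousCore, fun hle ↦ hfQ (hle (HomogeneousIdeal.mem_irrelevant_of_mem 𝒜 hd hf))⟩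
  have hx : x ∈ zeroLocus 𝒜 (I : Set A) :=
    (Ideal.homogeneousCore.gc 𝒜 I P).mp hIP
  exact hfQ (h hx rfl)

theorem isCompact_basicOpen {f : A} {d : ℕ} (hd : 0 < d) (hf : f ∈ 𝒜 d) :
    IsCompact (basicOpen 𝒜 f : Set (ProjectiveSpectrum 𝒜)) := by
  refine isCompact_of_finite_subcover fun {ι} U hU hcover ↦ ?_
  let J : ι → HomogeneousIdeal 𝒜 := fun i ↦ vanishingIdeal (U i)ᶜ
  have hJ (i : ι) : zeroLocus 𝒜 (J i : Set A) = (U i)ᶜ := by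
    rw [zeroLocus_vanishingIdeal_eq_closure, (hU i).isClosed_compl.closure_eq]
  have hrad : f ∈ (⨆ i, J i).toIdeal.radical := by
    refine mem_radical_of_zeroLocus_subset 𝒜 hd hf ?_
    rw [zeroLocus_iSup_homogeneousIdeal]
    simp only [hJ]
    rw [← Set.compl_iUnion, Set.compl_subset_comm, ← basicOpen_eq_zeroLocus_compl]
    exact hcover
  obtain ⟨n, hn⟩ := hrad
  rw [HomogeneousIdeal.toIdeal_iSup, Submodule.mem_iSup_iff_exists_finset] at hn
  obtain ⟨t, ht⟩ := hn
  refine ⟨t, fun x hx ↦ ?_⟩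
  by_contra hxt
  have hle : ⨆ i ∈ t, (J i).toIdeal ≤ x.asHomogeneousIdeal.toIdeal := by
    refine iSup₂_le fun i hi ↦ ?_
    have hxi : x ∈ zeroLocus 𝒜 (J i : Set A) := by
      rw [hJ]
      exact fun hxU ↦ hxt (Set.mem_biUnion hi hxU)
    exact hxi
  exact hx (x.isPrime.mem_of_pow_mem n (hle ht))

/-- The basic opens of homogeneous elements of positive degree form a basis of the topology. -/
theorem isTopologicalBasis_basicOpen_homogeneous_pos :
    TopologicalSpace.IsTopologicalBasis (Set.range fun f : {f : A // ∃ d > 0, f ∈ 𝒜 d} ↦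
      (basicOpen 𝒜 f.1 : Set (ProjectiveSpectrum 𝒜))) := by
  refine TopologicalSpace.isTopologicalBasis_of_isOpen_of_nhds ?_ fun x U hx hU ↦ ?_
  · rintro _ ⟨f, rfl⟩
    exact isOpen_basicOpen 𝒜
  obtain ⟨_, ⟨f, rfl⟩, hxf, hfU⟩ :=
    (isTopologicalBasis_basic_opens 𝒜).exists_subset_of_mem_open hx hU
  simp only [basicOpen_eq_union_of_projection 𝒜 f, TopologicalSpace.Opens.coe_iSup,
    Set.mem_iUnion, Set.iUnion_subset_iff] at hxf hfU
  obtain ⟨i, hi⟩ := hxf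
  obtain ⟨d, hd, g, hg, hxg⟩ : ∃ d > 0, ∃ g ∈ 𝒜 d, g ∉ x.asHomogeneousIdeal := by
    by_contra! h
    exact x.not_irrelevant_le ((HomogeneousIdeal.irrelevant_le 𝒜).mpr h)
  refine ⟨_, ⟨⟨GradedRing.proj 𝒜 i f * g, i + d, by lia,
    SetLike.mul_mem_graded (SetLike.coe_mem _) hg⟩, rfl⟩, ?_,
    Set.Subset.trans (basicOpen_mul_le_left 𝒜 _ g) (hfU i)⟩
  exact fun h ↦ (x.isPrime.mem_or_mem h).elim hi hxg

instance : PrespectralSpace (ProjectiveSpectrum 𝒜) :=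
  .of_isTopologicalBasis' (isTopologicalBasis_basicOpen_homogeneous_pos 𝒜) fun f ↦
    let ⟨_, hd, hf⟩ := f.2
    isCompact_basicOpen 𝒜 hd hf

instance : QuasiSeparatedSpace (ProjectiveSpectrum 𝒜) :=
  .of_isTopologicalBasis (isTopologicalBasis_basicOpen_homogeneous_pos 𝒜) fun f g ↦ by
    obtain ⟨d, hd, hf⟩ := f.2
    obtain ⟨e, -, hg⟩ := g.2
    rw [← TopologicalSpace.Opens.coe_inf, ← basicOpen_mul]
    exact isCompact_basicOpen 𝒜 (Nat.add_pos_left hd e) (SetLike.mul_mem_graded hf hg)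

end ProjectiveSpectrum


/-- Let `A` be a positively graded commutative ring which is finitely generated as an
`A₀`-algebra. Then the quasi-compact open subsets of `Proj A` form a basis of the topology,
and the intersection of any two quasi-compact open subsets of `Proj A` is quasi-compact. -/
theorem projectiveSpectrum_compact_open_basis {R A : Type*} [CommSemiring R] [CommRing A]
    [Algebra R A] (𝒜 : ℕ → Submodule R A) [GradedAlgebra 𝒜]
    (hfg : (HomogeneousIdeal.irrelevant 𝒜).toIdeal.FG) :
    TopologicalSpace.IsTopologicalBasis
      {U : Set (ProjectiveSpectrum 𝒜) | IsOpen U ∧ IsCompact U} ∧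
    (∀ U V : Set (ProjectiveSpectrum 𝒜),
      IsOpen U → IsCompact U → IsOpen V → IsCompact V → IsCompact (U ∩ V)) := by
  exact ⟨PrespectralSpace.isTopologicalBasis,
    fun _ _ hU hUc hV hVc ↦ hUc.inter_of_isOpen hVc hU hV⟩
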